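/- arXiv:2311.04135 — 2 statements merged into one kernel-verified Lean document; each statement's English description precedes it below -/
import Mathlib

section
/- Let H be a symmetric real m×m matrix, A a symmetric positive definite real m×m matrix, g ∈ ℝ^m with g ≠ 0, and c ∈ ℝ. Define the quadratic model Q(x) = c + gᵀ(x − θ) + ½(x − θ)ᵀ H (x − θ) around a point θ ∈ ℝ^m. If the matrix 2A⁻¹ − A⁻¹ H A⁻¹ is positive definite (i.e., A⁻¹ H A⁻¹ ≺ 2A⁻¹), then the preconditioned update θ' = θ − A⁻¹ g strictly decreases the quadratic model: Q(θ') < Q(θ). -/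
open Matrix

/-- If `2A⁻¹ − A⁻¹ H A⁻¹` is positive definite, then the preconditioned update
`θ' = θ − A⁻¹ g` strictly decreases the quadratic model
`Q(x) = c + gᵀ(x−θ) + ½(x−θ)ᵀ H (x−θ)`. -/
theorem preconditioned_update_decreases_quadratic_model {m : ℕ}
    (H A : Matrix (Fin m) (Fin m) ℝ) (hH : H.IsSymm)
    (hAsymm : A.IsSymm) (hApd : A.PosDef)
    (g : Fin m → ℝ) (hg : g ≠ 0) (c : ℝ) (θ : Fin m → ℝ)
    (Q : (Fin m → ℝ) → ℝ)
    (hQ : ∀ x, Q x = c + g ⬝ᵥ (x - θ) + (1 / 2) * ((x - θ) ⬝ᵥ H.mulVec (x - θ)))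
    (hcond : ((2 : ℝ) • A⁻¹ - A⁻¹ * H * A⁻¹).PosDef) :
    Q (θ - A⁻¹.mulVec g) < Q θ := by
  have hpos := hcond.dotProduct_mulVec_pos hg
  have hquad : g ⬝ᵥ (A⁻¹ * H * A⁻¹).mulVec g
      = A⁻¹.mulVec g ⬝ᵥ H.mulVec (A⁻¹.mulVec g) := by
    have hinv : A⁻¹ᵀ = A⁻¹ := by rw [transpose_nonsing_inv, hAsymm.eq]
    rw [← mulVec_mulVec, ← mulVec_mulVec, dotProduct_mulVec, ← mulVec_transpose, hinv]
  rw [star_trivial, sub_mulVec, smul_mulVec, dotProduct_sub, dotProduct_smul, hquad,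
    smul_eq_mul] at hpos
  have hstep : θ - A⁻¹.mulVec g - θ = -A⁻¹.mulVec g := by abel
  rw [hQ, hQ, hstep, sub_self]
  simp only [mulVec_neg, dotProduct_neg, neg_dotProduct, neg_neg, dotProduct_zero,
    zero_dotProduct]
  linarith
end

section
/- Let p : (Fin m → ℝ) → (Fin K → ℝ) be a twice continuously differentiable family of probability distributions with Σ_l p_l(θ') = 1 for all θ', and fix θ with p_l strictly positive in a neighborhood of θ. Define KL(ε) = Σ_l p_l(θ)·log(p_l(θ)/p_l(θ + ε)). Then for all indices i, j, the second partial derivative ∂²KL/∂ε_i∂ε_j at ε = 0 equals the classical Fisher information matrix entry [F_C(θ)]_{ij} = Σ_l (1/p_l(θ))·∂_ip_l(θ)·∂_jp_l(θ); i.e., to second order, KL(ε) ≈ ½ εᵀ F_C(θ) ε. -/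
theorem HasFDerivAt.comp_const_add {E F : Type*} [NormedAddCommGroup E] [NormedSpace ℝ E]
    [NormedAddCommGroup F] [NormedSpace ℝ F] {f : E → F} {f' : E →L[ℝ] F} (a x : E)
    (hf : HasFDerivAt f f' (a + x)) : HasFDerivAt (fun y => f (a + y)) f' x := by
  simpa [Function.comp_def] using hf.comp x ((hasFDerivAt_id x).const_add a)

/-- The Hessian of the KL-divergence `KL(ε) = Σ_l p_l(θ)·log(p_l(θ)/p_l(θ+ε))` at
`ε = 0` equals the classical Fisher information matrix:
`∂²KL/∂ε_i∂ε_j |_{ε=0} = Σ_l (1/p_l(θ))·∂ᵢp_l(θ)·∂ⱼp_l(θ)`. -/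
theorem KL_hessian_eq_CFIM {m K : ℕ}
    (p : (Fin m → ℝ) → Fin K → ℝ) (hdiff : ContDiff ℝ 2 p)
    (hsum : ∀ θ', ∑ l, p θ' l = 1)
    (θ : Fin m → ℝ)
    (U : Set (Fin m → ℝ)) (hU : U ∈ nhds θ)
    (hposU : ∀ θ' ∈ U, ∀ l, 0 < p θ' l)
    (KLdiv : (Fin m → ℝ) → ℝ)
    (hKL : ∀ ε, KLdiv ε = ∑ l, p θ l * Real.log (p θ l / p (θ + ε) l))
    (i j : Fin m) :
    fderiv ℝ (fun ε => fderiv ℝ KLdiv ε (Pi.single j 1)) 0 (Pi.single i 1)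
      = ∑ l, (1 / p θ l) *
          fderiv ℝ (fun θ' => p θ' l) θ (Pi.single i 1) *
          fderiv ℝ (fun θ' => p θ' l) θ (Pi.single j 1) := by
  have hpl (l : Fin K) : ContDiff ℝ 2 (fun x => p x l) := contDiff_pi.mp hdiff l
  have hp (l : Fin K) (x : Fin m → ℝ) : DifferentiableAt ℝ (fun x => p x l) x :=
    (hpl l).differentiable (by norm_num) x
  set g : Fin K → (Fin m → ℝ) → ℝ :=
    fun l x => fderiv ℝ (fun θ' => p θ' l) x (Pi.single j 1) with hg
  have hgd (l : Fin K) (x : Fin m → ℝ) : DifferentiableAt ℝ (g l) x :=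
    (((hpl l).fderiv_right (m := 1) (by norm_num)).clm_apply contDiff_const).differentiable
      (by norm_num) x
  have hgsum (x : Fin m → ℝ) : ∑ l, g l x = 0 := by
    have h : HasFDerivAt (fun x => ∑ l, p x l) (∑ l, fderiv ℝ (fun θ' => p θ' l) x) x :=
      HasFDerivAt.fun_sum fun l _ => (hp l x).hasFDerivAt
    simp only [hsum] at h
    have h' := DFunLike.congr_fun (h.unique (hasFDerivAt_const 1 x)) (Pi.single j 1)
    simpa [sum_apply] using h'
  have hgsum' : ∑ l, fderiv ℝ (g l) θ (Pi.single i 1) = 0 := by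
    have h : HasFDerivAt (fun x => ∑ l, g l x) (∑ l, fderiv ℝ (g l) θ) θ :=
      HasFDerivAt.fun_sum fun l _ => (hgd l θ).hasFDerivAt
    simp only [hgsum] at h
    have h' := DFunLike.congr_fun (h.unique (hasFDerivAt_const 0 θ)) (Pi.single i 1)
    simpa [sum_apply] using h'
  have hpos (l : Fin K) : 0 < p θ l := hposU θ (mem_of_mem_nhds hU) l
  have hshift : Filter.Tendsto (fun ε : Fin m → ℝ => θ + ε) (nhds 0) (nhds θ) := by
    simpa using (continuous_const_add θ).tendsto (0 : Fin m → ℝ)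
  have hev : ∀ᶠ ε in nhds (0 : Fin m → ℝ), ∀ l, 0 < p (θ + ε) l :=
    (hshift.eventually hU).mono fun ε hε => hposU _ hε
  have hKLev : KLdiv =ᶠ[nhds 0]
      fun ε => ∑ l, p θ l * (Real.log (p θ l) - Real.log (p (θ + ε) l)) := by
    filter_upwards [hev] with ε hε
    rw [hKL]
    exact Finset.sum_congr rfl fun l _ => by rw [Real.log_div (hpos l).ne' (hε l).ne']
  have hgrad : (fun ε => fderiv ℝ KLdiv ε (Pi.single j 1)) =ᶠ[nhds 0]
      fun ε => ∑ l, p θ l * (-(g l (θ + ε) / p (θ + ε) l)) := by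
    filter_upwards [hKLev.fderiv (𝕜 := ℝ), hev] with ε hε hε'
    rw [hε]
    have h := HasFDerivAt.fun_sum (u := Finset.univ) fun l _ =>
      ((((hp l (θ + ε)).hasFDerivAt.comp_const_add θ ε).log (hε' l).ne').const_sub
        (Real.log (p θ l))).const_mul (p θ l)
    rw [h.fderiv]
    simp [sum_apply, hg, div_eq_inv_mul]
  rw [hgrad.fderiv_eq]
  have hθ (l : Fin K) : p (θ + 0) l ≠ 0 := by simpa using (hpos l).ne'
  have h := HasFDerivAt.fun_sum (u := Finset.univ) fun l _ =>
    (((hgd l (θ + 0)).hasFDerivAt.comp_const_add θ 0).fun_mul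
      ((hasDerivAt_inv (hθ l)).comp_hasFDerivAt 0
        ((hp l (θ + 0)).hasFDerivAt.comp_const_add θ 0))).fun_neg.const_mul (p θ l)
  simp only [Function.comp_def, ← div_eq_mul_inv] at h
  rw [h.fderiv, ← sub_eq_zero, ← neg_eq_zero, ← hgsum', sum_apply,
    ← Finset.sum_sub_distrib, ← Finset.sum_neg_distrib]
  refine Finset.sum_congr rfl fun l _ => ?_
  have := (hpos l).ne'
  simp
  field_simp
  ring
end
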